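/- The Bailey–Borwein–Girgensohn identity: π² = 36·Li₂(1/2) − 36·Li₂(1/4) − 12·Li₂(1/8) + 6·Li₂(1/64). -/

import Mathlib

open Real

/-- The dilogarithm, `Li₂(z) = ∑_{k=1}^∞ z^k / k²`. -/
noncomputable def Li2 (z : ℝ) : ℝ := ∑' k : ℕ, z ^ (k + 1) / ((k : ℝ) + 1) ^ 2

lemma summable_one_div_add_one_sq : Summable fun k : ℕ => 1 / ((k : ℝ) + 1) ^ 2 := by
  simpa using (summable_nat_add_iff 1).2 (Real.summable_one_div_nat_pow.2 one_lt_two)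

lemma norm_Li2_term_le {x : ℝ} (hx : |x| ≤ 1) (k : ℕ) :
    ‖x ^ (k + 1) / ((k : ℝ) + 1) ^ 2‖ ≤ 1 / ((k : ℝ) + 1) ^ 2 := by
  rw [norm_div, norm_pow, norm_pow, Real.norm_eq_abs, Real.norm_eq_abs,
    abs_of_nonneg (by positivity : (0 : ℝ) ≤ (k : ℝ) + 1)]
  gcongr
  exact pow_le_one₀ (abs_nonneg x) hx

lemma continuousOn_Li2 : ContinuousOn Li2 (Set.Icc (-1) 1) :=
  continuousOn_tsum (fun k => by fun_prop) summable_one_div_add_one_sq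
    fun k _ hx => norm_Li2_term_le (abs_le.2 hx) k

lemma summable_Li2 {x : ℝ} (hx : |x| ≤ 1) :
    Summable fun k : ℕ => x ^ (k + 1) / ((k : ℝ) + 1) ^ 2 :=
  summable_one_div_add_one_sq.of_norm_bounded (norm_Li2_term_le hx)

lemma hasDerivAt_Li2 {x : ℝ} (hx : |x| < 1) (hx0 : x ≠ 0) :
    HasDerivAt Li2 (-log (1 - x) / x) x := by
  obtain ⟨r, hxr, hr⟩ := exists_between hx
  have hr0 : 0 < r := (abs_nonneg x).trans_lt hxr
  have hsum : ∑' k : ℕ, x ^ k / ((k : ℝ) + 1) = -log (1 - x) / x := by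
    have h := (hasSum_pow_div_log_of_abs_lt_one hx).div_const x
    rw [← h.tsum_eq]
    congr 1 with k
    field_simp
    ring
  rw [← hsum]
  refine hasDerivAt_tsum_of_isPreconnected
    (g := fun (k : ℕ) (y : ℝ) => y ^ (k + 1) / ((k : ℝ) + 1) ^ 2)
    (g' := fun (k : ℕ) (y : ℝ) => y ^ k / ((k : ℝ) + 1))
    (summable_geometric_of_lt_one hr0.le hr)
    (Metric.isOpen_ball (x := (0 : ℝ)) (ε := r)) (convex_ball _ _).isPreconnected
    (fun k y _ => ?_) (fun k y hy => ?_) (y₀ := 0) (by simpa using hr0)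
    (summable_Li2 (by simp)) (by simpa using hxr)
  · refine ((hasDerivAt_pow (k + 1) y).div_const _).congr_deriv ?_
    push_cast
    field_simp
  · have hy' : |y| < r := by simpa using hy
    rw [norm_div, norm_pow, Real.norm_eq_abs, Real.norm_eq_abs,
      abs_of_nonneg (by positivity : (0 : ℝ) ≤ (k : ℝ) + 1)]
    calc |y| ^ k / ((k : ℝ) + 1) ≤ |y| ^ k := div_le_self (by positivity) (by simp)
      _ ≤ r ^ k := by gcongr

lemma Li2_zero : Li2 0 = 0 := by simp [Li2]

lemma Li2_one : Li2 1 = π ^ 2 / 6 := by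
  have h := (hasSum_nat_add_iff' 1).2 hasSum_zeta_two
  simpa [Li2] using h.tsum_eq

/-- The duplication formula for the dilogarithm. -/
lemma Li2_sq {x : ℝ} (hx : |x| ≤ 1) : Li2 (x ^ 2) = 2 * Li2 x + 2 * Li2 (-x) := by
  have h1 := summable_Li2 hx
  have h2 := summable_Li2 (x := -x) (by simpa using hx)
  have hodd : Function.Injective fun k : ℕ => 2 * k + 1 := fun a b hab => by
    simp only at hab
    omega
  have key : ∑' k : ℕ, (x ^ (k + 1) / ((k : ℝ) + 1) ^ 2 + (-x) ^ (k + 1) / ((k : ℝ) + 1) ^ 2) =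
      ∑' k : ℕ, (x ^ 2) ^ (k + 1) / ((k : ℝ) + 1) ^ 2 / 2 := by
    rw [← hodd.tsum_eq]
    · congr 1 with k
      have e : 2 * k + 1 + 1 = 2 * (k + 1) := by ring
      rw [e, pow_mul, pow_mul, neg_sq]
      push_cast
      have : (k : ℝ) + 1 ≠ 0 := by positivity
      have e2 : (2 : ℝ) * k + 1 + 1 = 2 * (k + 1) := by ring
      rw [e2]
      field_simp
      norm_num
    · intro k hk
      rcases Nat.even_or_odd k with he | ho
      · exact absurd (by simp only [he.add_one.neg_pow]; ring) hk
      · obtain ⟨m, rfl⟩ := ho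
        exact ⟨m, rfl⟩
  rw [h1.tsum_add h2, tsum_div_const] at key
  simp only [Li2]
  linarith

lemma eq_of_hasDerivAt_eq_zero {f : ℝ → ℝ} {a b : ℝ} (hab : a < b)
    (hc : ContinuousOn f (Set.Icc a b)) (hd : ∀ x ∈ Set.Ioo a b, HasDerivAt f 0 x) :
    f a = f b := by
  obtain ⟨c, -, hc⟩ := exists_hasDerivAt_eq_slope f (fun _ => 0) hab hc hd
  rw [eq_comm, div_eq_zero_iff] at hc
  rcases hc with h | h <;> linarith

/-- Landen's identity for the dilogarithm. -/
lemma Li2_add_Li2_neg_div {x : ℝ} (hx0 : 0 < x) (hx : x < 1 / 2) :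
    Li2 x + Li2 (-(x / (1 - x))) = -(log (1 - x) ^ 2 / 2) := by
  have hbound : ∀ y : ℝ, 0 ≤ y → y < 1 / 2 → y / (1 - y) < 1 := fun y _ hy => by
    rw [div_lt_one (by linarith)]
    linarith
  have hpos : ∀ y : ℝ, 0 ≤ y → y < 1 / 2 → 0 ≤ y / (1 - y) := fun y h0 hy =>
    div_nonneg h0 (by linarith)
  have h := eq_of_hasDerivAt_eq_zero
    (f := fun y => Li2 y + Li2 (-(y / (1 - y))) + log (1 - y) ^ 2 / 2) hx0 ?_ ?_
  · simp [Li2_zero] at h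
    linarith
  · refine ContinuousOn.add (ContinuousOn.add ?_ ?_) ?_
    · exact continuousOn_Li2.mono (Set.Icc_subset_Icc (by norm_num) (by linarith))
    · refine continuousOn_Li2.comp (f := fun y : ℝ => -(y / (1 - y))) ?_ ?_
      · refine (continuousOn_id.div (by fun_prop) fun y hy => ?_).neg
        have := hy.2
        exact (by linarith : 0 < 1 - y).ne'
      · intro y hy
        have h1 := hbound y hy.1 (hy.2.trans_lt hx)
        have h2 := hpos y hy.1 (hy.2.trans_lt hx)
        constructor <;> linarith
    · refine ((ContinuousOn.log (by fun_prop) fun y hy => ?_).pow 2).div_const 2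
      have := hy.2
      exact (by linarith : 0 < 1 - y).ne'
  · rintro y ⟨hy0, hyx⟩
    have hy : y < 1 / 2 := hyx.trans hx
    have h1y : 0 < 1 - y := by linarith
    have hq : 0 < y / (1 - y) := div_pos hy0 h1y
    have hsub : HasDerivAt (fun y : ℝ => 1 - y) (-1) y := by
      simpa using (hasDerivAt_id y).const_sub 1
    have d1 := hasDerivAt_Li2 (x := y) (by rw [abs_of_pos hy0]; linarith) hy0.ne'
    have d2 := hasDerivAt_Li2 (x := -(y / (1 - y)))
      (by rw [abs_neg, abs_of_pos hq]; exact hbound y hy0.le hy) (neg_ne_zero.2 hq.ne')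
    have d3 := d2.comp y ((hasDerivAt_id y).div hsub h1y.ne').neg
    have d4 := ((hsub.log h1y.ne').pow 2).div_const 2
    refine ((d1.add d3).add d4).congr_deriv ?_
    have e : 1 - -(y / (1 - y)) = (1 - y)⁻¹ := by
      field_simp
      ring
    rw [e, log_inv]
    simp only [id]
    field_simp
    ring

lemma continuousAt_log_mul_log_one_sub_zero :
    ContinuousAt (fun x : ℝ => log x * log (1 - x)) 0 := by
  have hd : DifferentiableAt ℝ (fun x : ℝ => log (1 - x)) 0 :=
    DifferentiableAt.log (by fun_prop) (by norm_num)
  have h := continuous_mul_log.continuousAt.mul (continuousAt_dslope_same.2 hd)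
  refine h.congr (Filter.Eventually.of_forall fun x => ?_)
  have e := sub_smul_dslope (fun x : ℝ => log (1 - x)) 0 x
  simp only [sub_zero, smul_eq_mul, log_one] at e
  simp only [Pi.mul_apply]
  rw [← e]
  ring

/-- Euler's reflection formula for the dilogarithm, at `1 / 2`. -/
lemma Li2_half : Li2 (1 / 2) = π ^ 2 / 12 - log 2 ^ 2 / 2 := by
  have h := eq_of_hasDerivAt_eq_zero
    (f := fun y => Li2 y + Li2 (1 - y) + log y * log (1 - y)) (a := 0) (b := 1 / 2)
    (by norm_num) ?_ ?_
  · have e : (1 : ℝ) - 1 / 2 = 1 / 2 := by norm_num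
    simp only [e, sub_zero, Li2_zero, Li2_one, log_zero] at h
    rw [one_div, log_inv, ← one_div] at h
    linarith
  · refine ContinuousOn.add (ContinuousOn.add ?_ ?_) fun y hy => ?_
    · exact continuousOn_Li2.mono (Set.Icc_subset_Icc (by norm_num) (by norm_num))
    · refine continuousOn_Li2.comp (f := fun y : ℝ => 1 - y) (by fun_prop) ?_
      intro y hy
      constructor <;> linarith [hy.1, hy.2]
    · apply ContinuousAt.continuousWithinAt
      rcases hy.1.eq_or_lt with rfl | h0
      · exact continuousAt_log_mul_log_one_sub_zero
      · have h1 : 0 < 1 - y := by linarith [hy.2]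
        exact (continuousAt_log h0.ne').mul (ContinuousAt.log (by fun_prop) h1.ne')
  · rintro y ⟨hy0, hy⟩
    have h1y : 0 < 1 - y := by linarith
    have hsub : HasDerivAt (fun y : ℝ => 1 - y) (-1) y := by
      simpa using (hasDerivAt_id y).const_sub 1
    have d1 := hasDerivAt_Li2 (x := y) (by rw [abs_of_pos hy0]; linarith) hy0.ne'
    have d2 := (hasDerivAt_Li2 (x := 1 - y)
      (by rw [abs_of_pos h1y]; linarith) h1y.ne').comp y hsub
    have d3 := (hasDerivAt_log hy0.ne').mul (hsub.log h1y.ne')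
    refine ((d1.add d2).add d3).congr_deriv ?_
    rw [sub_sub_cancel]
    field_simp
    ring

theorem stmt_18 :
    Real.pi ^ 2 =
      36 * Li2 (1 / 2) - 36 * Li2 (1 / 4) - 12 * Li2 (1 / 8) + 6 * Li2 (1 / 64) := by
  have s2 := Li2_sq (x := 1 / 2) (by norm_num [abs_le])
  have s3 := Li2_sq (x := 1 / 3) (by norm_num [abs_le])
  have s8 := Li2_sq (x := 1 / 8) (by norm_num [abs_le])
  have l3 := Li2_add_Li2_neg_div (x := 1 / 3) (by norm_num) (by norm_num)
  have l4 := Li2_add_Li2_neg_div (x := 1 / 4) (by norm_num) (by norm_num)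
  have l9 := Li2_add_Li2_neg_div (x := 1 / 9) (by norm_num) (by norm_num)
  have hh := Li2_half
  have e3 : log (1 - 1 / 3) = log 2 - log 3 := by
    rw [← log_div (by norm_num) (by norm_num)]
    norm_num
  have e4 : log (1 - 1 / 4) = log 3 - 2 * log 2 := by
    rw [show (1 : ℝ) - 1 / 4 = 3 / 2 ^ 2 by norm_num, log_div (by norm_num) (by norm_num), log_pow]
    norm_num
  have e9 : log (1 - 1 / 9) = 3 * log 2 - 2 * log 3 := by
    rw [show (1 : ℝ) - 1 / 9 = 2 ^ 3 / 3 ^ 2 by norm_num, log_div (by norm_num) (by norm_num),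
      log_pow, log_pow]
    norm_num
  rw [e3, show -((1 : ℝ) / 3 / (1 - 1 / 3)) = -(1 / 2) by norm_num] at l3
  rw [e4, show -((1 : ℝ) / 4 / (1 - 1 / 4)) = -(1 / 3) by norm_num] at l4
  rw [e9, show -((1 : ℝ) / 9 / (1 - 1 / 9)) = -(1 / 8) by norm_num] at l9
  rw [show ((1 : ℝ) / 2) ^ 2 = 1 / 4 by norm_num] at s2
  rw [show ((1 : ℝ) / 3) ^ 2 = 1 / 9 by norm_num] at s3
  rw [show ((1 : ℝ) / 8) ^ 2 = 1 / 64 by norm_num] at s8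
  linarith
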